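/- arXiv:1010.5938 — 2 statements merged into one kernel-verified Lean document; each statement's English description precedes it below -/
import Mathlib

section
/- Suppose ‖h‖₂² = 2d/M, the A_Φ-eigenvalues e^{±iθ_iT_s} are pairwise distinct and each has nonzero imaginary part, and v_i^H h ≠ 0 for all i = 1,…,d. Let δ₀ = (A₂κ₂² − A₁κ₁²)/(A₂κ₂² + A₁κ₁²) and choose any ε with 0 < ε < 1 − δ₀. If M ≥ 2(2d−1)ν/ε, then with C = d(κ₁²/A₂ + κ₂²/A₁), for all x, y ∈ 𝓜 with x ≠ y, C(1−δ₀−ε)·‖x−y‖₂² ≤ ‖F(x)−F(y)‖₂² ≤ C(1+δ₀+ε)·‖x−y‖₂²; that is, F is a stable embedding of 𝓜 with conditioning at most δ₀ + ε. -/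
open Complex Matrix Finset


lemma aux_geom (z : ℂ) (hz : ‖z‖ = 1) (hz1 : z ≠ 1) (M : ℕ) :
    ‖∑ k : Fin M, z ^ (k : ℕ)‖ ≤ 2 / ‖z - 1‖ := by
  have h0 : 0 < ‖z - 1‖ := norm_pos_iff.2 (sub_ne_zero.2 hz1)
  rw [Fin.sum_univ_eq_sum_range (fun k => z ^ k) M, geom_sum_eq hz1, norm_div]
  gcongr
  calc ‖z ^ M - 1‖ ≤ ‖z ^ M‖ + ‖(1 : ℂ)‖ := norm_sub_le _ _
    _ = 2 := by rw [norm_pow, hz]; norm_num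

lemma aux_gram (n M : ℕ) (c μ : Fin n → ℂ) (hμ : ∀ j, ‖μ j‖ = 1) (B : ℝ)
    (hB : ∀ j l, j ≠ l → ‖∑ k : Fin M, (μ j * (starRingEnd ℂ) (μ l)) ^ (k : ℕ)‖ ≤ B) :
    |∑ k : Fin M, ‖∑ j, c j * μ j ^ (k : ℕ)‖ ^ 2 - M * ∑ j, ‖c j‖ ^ 2|
      ≤ ((n : ℝ) - 1) * B * ∑ j, ‖c j‖ ^ 2 := by
  have e1 : ((∑ k : Fin M, ‖∑ j, c j * μ j ^ (k : ℕ)‖ ^ 2 : ℝ) : ℂ)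
      = ∑ j, ∑ l, (c j * (starRingEnd ℂ) (c l)) *
        ∑ k : Fin M, (μ j * (starRingEnd ℂ) (μ l)) ^ (k : ℕ) := by
    push_cast
    simp_rw [← Complex.mul_conj', map_sum, Finset.sum_mul_sum, Finset.mul_sum]
    rw [Finset.sum_comm]
    refine Finset.sum_congr rfl fun j _ => ?_
    rw [Finset.sum_comm]
    refine Finset.sum_congr rfl fun l _ => Finset.sum_congr rfl fun k _ => ?_
    simp only [map_mul, map_pow, mul_pow]
    ring
  have e2 : ((∑ k : Fin M, ‖∑ j, c j * μ j ^ (k : ℕ)‖ ^ 2 - M * ∑ j, ‖c j‖ ^ 2 : ℝ) : ℂ)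
      = ∑ j, ∑ l ∈ Finset.univ.erase j, (c j * (starRingEnd ℂ) (c l)) *
        ∑ k : Fin M, (μ j * (starRingEnd ℂ) (μ l)) ^ (k : ℕ) := by
    rw [Complex.ofReal_sub, e1]
    push_cast
    rw [Finset.mul_sum, ← Finset.sum_sub_distrib]
    refine Finset.sum_congr rfl fun j _ => ?_
    rw [← Finset.add_sum_erase _ _ (Finset.mem_univ j), Complex.mul_conj', Complex.mul_conj', hμ j]
    simp
    ring
  rw [← Real.norm_eq_abs, ← Complex.norm_real, e2]
  calc _ ≤ ∑ j, ∑ l ∈ Finset.univ.erase j, B * ((‖c j‖ ^ 2 + ‖c l‖ ^ 2) / 2) := by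
        refine (norm_sum_le _ _).trans (Finset.sum_le_sum fun j _ => ?_)
        refine (norm_sum_le _ _).trans (Finset.sum_le_sum fun l hl => ?_)
        have hb := hB j l (Finset.ne_of_mem_erase hl).symm
        rw [norm_mul, norm_mul, RCLike.norm_conj, mul_comm]
        have := two_mul_le_add_sq ‖c j‖ ‖c l‖
        have hB0 := (norm_nonneg _).trans hb
        exact mul_le_mul hb (by linarith) (by positivity) hB0
    _ = _ := by
        have : ∀ j : Fin n, ∑ l ∈ Finset.univ.erase j, B * ((‖c j‖ ^ 2 + ‖c l‖ ^ 2) / 2)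
            = B * ((((n:ℝ) - 2) * ‖c j‖ ^ 2 + ∑ l, ‖c l‖ ^ 2) / 2) := by
          intro j
          have := Finset.add_sum_erase Finset.univ (fun l => B * ((‖c j‖ ^ 2 + ‖c l‖ ^ 2) / 2)) (Finset.mem_univ j)
          have h2 : ∑ l, B * ((‖c j‖ ^ 2 + ‖c l‖ ^ 2) / 2) = B * ((n * ‖c j‖ ^ 2 + ∑ l, ‖c l‖ ^ 2) / 2) := by
            rw [← Finset.mul_sum, ← Finset.sum_div, Finset.sum_add_distrib]
            simp
          rw [h2] at this
          linarith
        simp_rw [this]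
        rw [← Finset.mul_sum, ← Finset.sum_div, Finset.sum_add_distrib, ← Finset.mul_sum]
        simp
        ring

lemma aux_ray {N n : ℕ} (V : Matrix (Fin N) (Fin n) ℂ) (hH : (Vᴴ * V).IsHermitian)
    (x : Fin n → ℂ) :
    (⨅ i, hH.eigenvalues i) * ∑ j, ‖x j‖ ^ 2 ≤ ∑ i, ‖∑ j, V i j * x j‖ ^ 2 ∧
    ∑ i, ‖∑ j, V i j * x j‖ ^ 2 ≤ (⨆ i, hH.eigenvalues i) * ∑ j, ‖x j‖ ^ 2 := by
  set e := hH.eigenvectorBasis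
  let X : EuclideanSpace ℂ (Fin n) := WithLp.toLp 2 x
  have hx : ∑ j, ‖x j‖ ^ 2 = ∑ j, ‖inner ℂ (e j) X‖ ^ 2 := by
    rw [e.sum_sq_norm_inner_right, EuclideanSpace.norm_sq_eq]
  have key : ∑ i, ‖∑ j, V i j * x j‖ ^ 2 = ∑ j, hH.eigenvalues j * ‖inner ℂ (e j) X‖ ^ 2 := by
    have h1 : ((∑ i, ‖∑ j, V i j * x j‖ ^ 2 : ℝ) : ℂ) = inner ℂ X (Matrix.toEuclideanLin (Vᴴ * V) X) := by
      have : inner ℂ X (Matrix.toEuclideanLin (Vᴴ * V) X) = (V *ᵥ x) ⬝ᵥ star (V *ᵥ x) := by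
        rw [EuclideanSpace.inner_eq_star_dotProduct]
        simp only [X, Matrix.toLpLin_apply]
        rw [← Matrix.mulVec_mulVec, dotProduct_comm, Matrix.dotProduct_mulVec, Matrix.vecMul_conjTranspose, star_star, dotProduct_comm]
      rw [this]
      simp only [dotProduct, Matrix.mulVec, Pi.star_apply, RCLike.star_def, Complex.mul_conj']
      push_cast
      rfl
    have h2 : inner ℂ X (Matrix.toEuclideanLin (Vᴴ * V) X) = ((∑ j, hH.eigenvalues j * ‖inner ℂ (e j) X‖ ^ 2 : ℝ) : ℂ) := by
      rw [← e.sum_inner_mul_inner]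
      push_cast
      refine Finset.sum_congr rfl fun j _ => ?_
      have hs := Matrix.isSymmetric_toEuclideanLin_iff.2 hH
      rw [← hs (e j) X]
      have : Matrix.toEuclideanLin (Vᴴ * V) (e j) = (hH.eigenvalues j : ℂ) • e j := by
        have := hH.mulVec_eigenvectorBasis j
        rw [Matrix.toLpLin_apply]
        apply (WithLp.ofLp_injective 2)
        simp only [WithLp.ofLp_smul]
        exact this
      rw [this, inner_smul_left, Complex.conj_ofReal, ← inner_conj_symm X (e j), ← Complex.conj_mul']
      ring
    exact_mod_cast h1.trans h2
  rw [key, hx, Finset.mul_sum, Finset.mul_sum]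
  constructor
  · refine Finset.sum_le_sum fun j _ => mul_le_mul_of_nonneg_right ?_ (by positivity)
    exact ciInf_le (Set.finite_range _).bddBelow j
  · refine Finset.sum_le_sum fun j _ => mul_le_mul_of_nonneg_right ?_ (by positivity)
    exact le_ciSup (Set.finite_range _).bddAbove j

open scoped ComplexOrder in
lemma aux_pos {N n : ℕ} (hn : 0 < n) (V : Matrix (Fin N) (Fin n) ℂ) (hH : (Vᴴ * V).IsHermitian)
    (hr : V.rank = n) : 0 < (⨅ i, hH.eigenvalues i) ∧ 0 < (⨆ i, hH.eigenvalues i) := by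
  have hinj : Function.Injective V.mulVec := by
    have := LinearMap.finrank_range_add_finrank_ker V.mulVecLin
    rw [Matrix.rank] at hr
    rw [hr] at this
    simp only [Module.finrank_fintype_fun_eq_card, Fintype.card_fin] at this
    have h0 : Module.finrank ℂ (LinearMap.ker V.mulVecLin) = 0 := by omega
    rw [Submodule.finrank_eq_zero] at h0
    exact LinearMap.ker_eq_bot.1 h0
  have hp := Matrix.PosDef.conjTranspose_mul_self V hinj
  have : Nonempty (Fin n) := ⟨⟨0, hn⟩⟩
  have hpos : ∀ i, 0 < hH.eigenvalues i := fun i => hp.eigenvalues_pos i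
  constructor
  · obtain ⟨i, hi⟩ := exists_eq_ciInf_of_finite (f := hH.eigenvalues)
    rw [← hi]; exact hpos i
  · exact (hpos ⟨0, hn⟩).trans_le (le_ciSup (Set.finite_range _).bddAbove _)

lemma aux_exp (a b B : ℝ) (M : ℕ) (hab : Complex.exp (a * Complex.I) ≠ Complex.exp (b * Complex.I))
    (hB : 1 / |Real.sin ((a - b) / 2)| ≤ B) :
    ‖∑ k : Fin M, (Complex.exp (a * Complex.I) * (starRingEnd ℂ) (Complex.exp (b * Complex.I))) ^ (k : ℕ)‖ ≤ B := by
  have e : Complex.exp (a * Complex.I) * (starRingEnd ℂ) (Complex.exp (b * Complex.I))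
      = Complex.exp (Complex.I * ((a - b : ℝ) : ℂ)) := by
    rw [← Complex.exp_conj, ← Complex.exp_add]
    congr 1
    simp
    ring
  rw [e]
  refine (aux_geom _ ?_ ?_ M).trans (le_trans (le_of_eq ?_) hB)
  · rw [mul_comm]; exact Complex.norm_exp_ofReal_mul_I _
  · intro h1
    apply hab
    have : Complex.exp (a * Complex.I) = Complex.exp (Complex.I * ((a - b : ℝ) : ℂ)) * Complex.exp (b * Complex.I) := by
      rw [← Complex.exp_add]; congr 1; push_cast; ring
    rw [this, h1, one_mul]
  · rw [Complex.norm_exp_I_mul_ofReal_sub_one, Real.norm_eq_abs, abs_mul, abs_two]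
    by_cases hs : |Real.sin ((a - b) / 2)| = 0
    · simp [hs]
    · field_simp

/-- Corollary of the Stable Linear Takens' Embedding Theorem: with
`‖h‖₂² = 2d/M`, distinct strictly-complex `A_Φ`-eigenvalues, `v_i^H h ≠ 0`, and
`0 < ε < 1 − δ₀`, if `M ≥ 2(2d−1)ν/ε` then `F` is a stable embedding of `𝓜`
with conditioning at most `δ₀ + ε`. -/
theorem stmt2
    (N d M : ℕ) (hN : 0 < N) (hd : 0 < d) (hMpos : 0 < M) (hdN : 2 * d ≤ N)
    (θ : Fin d → ℝ) (hθpos : ∀ i, 0 < θ i) (hθinj : Function.Injective θ)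
    (Ts : ℝ) (hTs : 0 < Ts)
    (v : Fin d → Fin N → ℂ) (hvnorm : ∀ p, ∑ i, ‖v p i‖ ^ 2 = 1)
    (V : Matrix (Fin N) (Fin (2 * d)) ℂ)
    (hV : ∀ (i : Fin N) (j : Fin (2 * d)),
      V i j = if j.val % 2 = 0
        then v ⟨j.val / 2, by have := j.isLt; omega⟩ i
        else (starRingEnd ℂ) (v ⟨j.val / 2, by have := j.isLt; omega⟩ i))
    (hVrank : V.rank = 2 * d)
    (h : Fin N → ℝ) (hh : h ≠ 0)
    (μ : Fin (2 * d) → ℂ)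
    (hμ : ∀ j : Fin (2 * d),
      μ j = if j.val % 2 = 0
        then Complex.exp (-((θ ⟨j.val / 2, by have := j.isLt; omega⟩ * Ts : ℝ) : ℂ) * Complex.I)
        else Complex.exp (((θ ⟨j.val / 2, by have := j.isLt; omega⟩ * Ts : ℝ) : ℂ) * Complex.I))
    (G : Matrix (Fin M) (Fin (2 * d)) ℂ)
    (hG : ∀ (k : Fin M) (j : Fin (2 * d)), G k j = (∑ i, (h i : ℂ) * V i j) * μ j ^ (k : ℕ))
    (vh : Fin d → ℂ) (hvhdef : ∀ p, vh p = ∑ i, (starRingEnd ℂ) (v p i) * (h i : ℂ))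
    (α₀ : Fin (2 * d) → ℂ)
    (lam : Fin (2 * d) → ℂ)
    (hlam : ∀ j : Fin (2 * d),
      lam j = if j.val % 2 = 0
        then ((θ ⟨j.val / 2, by have := j.isLt; omega⟩ : ℝ) : ℂ) * Complex.I
        else -(((θ ⟨j.val / 2, by have := j.isLt; omega⟩ : ℝ) : ℂ)) * Complex.I)
    (X : ℝ → Fin N → ℂ)
    (hX : ∀ (t : ℝ) (i : Fin N), X t i = ∑ j, V i j * (Complex.exp (lam j * (t : ℂ)) * α₀ j))
    (FX : ℝ → Fin M → ℂ)
    (hFX : ∀ (t : ℝ) (k : Fin M), FX t k = ∑ j, G k j * (Complex.exp (lam j * (t : ℂ)) * α₀ j))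
    (hne : (Finset.univ : Finset (Fin d)).Nonempty)
    (κ₁ κ₂ : ℝ)
    (hκ₁def : κ₁ = Finset.univ.inf' hne fun p => ‖vh p‖ / Real.sqrt (∑ i, h i ^ 2))
    (hκ₂def : κ₂ = Finset.univ.sup' hne fun p => ‖vh p‖ / Real.sqrt (∑ i, h i ^ 2))
    (ν : ℝ)
    (hνdef : ν = sSup ({r : ℝ | ∃ p : Fin d, r = 1 / |Real.sin (θ p * Ts)|} ∪
      {r : ℝ | ∃ p q : Fin d, p ≠ q ∧
        (r = 1 / |Real.sin ((θ p - θ q) * Ts / 2)| ∨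
         r = 1 / |Real.sin ((θ p + θ q) * Ts / 2)|)}))
    (hHermV : (Vᴴ * V).IsHermitian) (A₁ A₂ : ℝ)
    (hA₁def : A₁ = ⨅ i, hHermV.eigenvalues i)
    (hA₂def : A₂ = ⨆ i, hHermV.eigenvalues i)
    (hμinj : Function.Injective μ) (hμim : ∀ j, (μ j).im ≠ 0)
    (hvh : ∀ p, vh p ≠ 0)
    (hhnorm : ∑ i, h i ^ 2 = 2 * (d : ℝ) / (M : ℝ))
    (C δ₀ : ℝ)
    (hCdef : C = (d : ℝ) * (κ₁ ^ 2 / A₂ + κ₂ ^ 2 / A₁))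
    (hδ₀def : δ₀ = (A₂ * κ₂ ^ 2 - A₁ * κ₁ ^ 2) / (A₂ * κ₂ ^ 2 + A₁ * κ₁ ^ 2))
    (ε : ℝ) (hε : 0 < ε) (hε' : ε < 1 - δ₀)
    (hMbig : (M : ℝ) ≥ 2 * (2 * (d : ℝ) - 1) * ν / ε) :
    ∀ tx ty : ℝ, X tx ≠ X ty →
      C * (1 - δ₀ - ε) * (∑ i, ‖X tx i - X ty i‖ ^ 2) ≤ ∑ k, ‖FX tx k - FX ty k‖ ^ 2 ∧
      ∑ k, ‖FX tx k - FX ty k‖ ^ 2 ≤ C * (1 + δ₀ + ε) * (∑ i, ‖X tx i - X ty i‖ ^ 2) := by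
  intro tx ty _
  subst hκ₁def hκ₂def hνdef hA₁def hA₂def
  obtain ⟨hA1, hA2⟩ := aux_pos (by omega) V hHermV hVrank
  set A₁ := ⨅ i, hHermV.eigenvalues i
  set A₂ := ⨆ i, hHermV.eigenvalues i
  set S := ({r : ℝ | ∃ p : Fin d, r = 1 / |Real.sin (θ p * Ts)|} ∪
      {r : ℝ | ∃ p q : Fin d, p ≠ q ∧
        (r = 1 / |Real.sin ((θ p - θ q) * Ts / 2)| ∨
         r = 1 / |Real.sin ((θ p + θ q) * Ts / 2)|)}) with hS
  have hSfin : S.Finite := by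
    have hf : ((Set.range fun p : Fin d => 1 / |Real.sin (θ p * Ts)|) ∪
      ((Set.range fun p : Fin d × Fin d => 1 / |Real.sin ((θ p.1 - θ p.2) * Ts / 2)|) ∪
      (Set.range fun p : Fin d × Fin d => 1 / |Real.sin ((θ p.1 + θ p.2) * Ts / 2)|))).Finite :=
      (Set.finite_range _).union ((Set.finite_range _).union (Set.finite_range _))
    refine hf.subset ?_
    rintro r (⟨p, rfl⟩ | ⟨p, q, _, rfl | rfl⟩)
    · exact Or.inl ⟨p, rfl⟩
    · exact Or.inr (Or.inl ⟨(p, q), rfl⟩)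
    · exact Or.inr (Or.inr ⟨(p, q), rfl⟩)
  have hSle : ∀ r ∈ S, r ≤ sSup S := fun r hr => le_csSup hSfin.bddAbove hr
  set ν := sSup S
  -- phases
  let P : Fin (2 * d) → Fin d := fun j => ⟨j.val / 2, by have := j.isLt; omega⟩
  let φ : Fin (2 * d) → ℝ := fun j => if j.val % 2 = 0 then -(θ (P j) * Ts) else θ (P j) * Ts
  have hμφ : ∀ j, μ j = Complex.exp ((φ j : ℝ) * Complex.I) := by
    intro j
    rw [hμ j]
    by_cases hj : j.val % 2 = 0
    · simp [φ, P, hj]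
    · simp [φ, P, hj]
  have hμn : ∀ j, ‖μ j‖ = 1 := fun j => by
    rw [hμφ]; exact Complex.norm_exp_ofReal_mul_I _
  have hB : ∀ j l, j ≠ l → ‖∑ k : Fin M, (μ j * (starRingEnd ℂ) (μ l)) ^ (k : ℕ)‖ ≤ ν := by
    intro j l hjl
    have hne' : μ j ≠ μ l := fun h => hjl (hμinj h)
    rw [hμφ j, hμφ l] at hne' ⊢
    refine aux_exp _ _ _ M hne' (hSle _ ?_)
    have habs : ∀ a b : ℝ, a = b ∨ a = -b → |Real.sin a| = |Real.sin b| := by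
      rintro a b (rfl | rfl)
      · rfl
      · rw [Real.sin_neg, abs_neg]
    by_cases hP : P j = P l
    · left
      refine ⟨P j, ?_⟩
      have hv : j.val / 2 = l.val / 2 := congrArg Fin.val hP
      have hv2 : j.val ≠ l.val := fun h => hjl (Fin.ext h)
      congr 1
      apply habs
      rcases Nat.mod_two_eq_zero_or_one j.val with hj | hj <;>
        rcases Nat.mod_two_eq_zero_or_one l.val with hl | hl
      · omega
      · right; simp [φ, hj, hl, hP]; ring
      · left; simp [φ, hj, hl, hP]
      · omega
    · right
      refine ⟨P j, P l, hP, ?_⟩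
      rcases Nat.mod_two_eq_zero_or_one j.val with hj | hj <;>
        rcases Nat.mod_two_eq_zero_or_one l.val with hl | hl
      · left; congr 1; apply habs; right; simp [φ, hj, hl]; ring
      · right; congr 1; apply habs; right; simp [φ, hj, hl]; ring
      · right; congr 1; apply habs; left; simp [φ, hj, hl]; ring
      · left; congr 1; apply habs; left; simp [φ, hj, hl]; ring
  -- h-norm
  have hd' : (0 : ℝ) < d := by exact_mod_cast hd
  have hM' : (0 : ℝ) < M := by exact_mod_cast hMpos
  have hhpos : 0 < ∑ i, h i ^ 2 := by rw [hhnorm]; positivity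
  set H := ∑ i, h i ^ 2
  have hsq : 0 < Real.sqrt H := Real.sqrt_pos.2 hhpos
  have hsq2 : Real.sqrt H ^ 2 = H := Real.sq_sqrt hhpos.le
  set κ₁ := Finset.univ.inf' hne fun p => ‖vh p‖ / Real.sqrt H with hκ₁
  set κ₂ := Finset.univ.sup' hne fun p => ‖vh p‖ / Real.sqrt H with hκ₂
  have hκ1pos : 0 < κ₁ := by
    rw [hκ₁, Finset.lt_inf'_iff]
    intro p _
    exact div_pos (norm_pos_iff.2 (hvh p)) hsq
  have hκ1le : ∀ p, κ₁ * Real.sqrt H ≤ ‖vh p‖ := fun p => by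
    rw [← le_div_iff₀ hsq]
    exact Finset.inf'_le (fun p => ‖vh p‖ / Real.sqrt H) (Finset.mem_univ p)
  have hκ2le : ∀ p, ‖vh p‖ ≤ κ₂ * Real.sqrt H := fun p => by
    rw [← div_le_iff₀ hsq]
    exact Finset.le_sup' (fun p => ‖vh p‖ / Real.sqrt H) (Finset.mem_univ p)
  have hκ2pos : 0 < κ₂ := by
    have h1 := hκ1le ⟨0, hd⟩
    have h2 := hκ2le ⟨0, hd⟩
    have h3 := mul_pos hκ1pos hsq
    exact pos_of_mul_pos_left (h3.trans_le (h1.trans h2)) hsq.le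
  let b : Fin (2 * d) → ℂ := fun j => ∑ i, (h i : ℂ) * V i j
  have hb : ∀ j, ‖b j‖ = ‖vh (P j)‖ := by
    intro j
    rw [hvhdef]
    simp only [b, hV]
    by_cases hj : j.val % 2 = 0
    · simp only [hj, if_true]
      rw [← RCLike.norm_conj, map_sum]
      congr 1
      refine Finset.sum_congr rfl fun i _ => ?_
      rw [map_mul, Complex.conj_ofReal, mul_comm]
    · simp only [hj, if_false]
      congr 1
      refine Finset.sum_congr rfl fun i _ => ?_
      rw [mul_comm]
  let α : Fin (2 * d) → ℂ := fun j =>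
    Complex.exp (lam j * (tx : ℂ)) * α₀ j - Complex.exp (lam j * (ty : ℂ)) * α₀ j
  have hXd : ∀ i, X tx i - X ty i = ∑ j, V i j * α j := by
    intro i
    rw [hX, hX, ← Finset.sum_sub_distrib]
    exact Finset.sum_congr rfl fun j _ => by simp only [α]; ring
  have hFd : ∀ k, FX tx k - FX ty k = ∑ j, (b j * α j) * μ j ^ (k : ℕ) := by
    intro k
    rw [hFX, hFX, ← Finset.sum_sub_distrib]
    exact Finset.sum_congr rfl fun j _ => by rw [hG]; simp only [α, b]; ring
  simp_rw [hXd, hFd]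
  obtain ⟨r1, r2⟩ := aux_ray V hHermV α
  have g := aux_gram (2 * d) M (fun j => b j * α j) μ hμn ν hB
  have c1 : κ₁ ^ 2 * H * ∑ j, ‖α j‖ ^ 2 ≤ ∑ j, ‖b j * α j‖ ^ 2 := by
    rw [Finset.mul_sum]
    refine Finset.sum_le_sum fun j _ => ?_
    rw [norm_mul, mul_pow, hb, ← hsq2, ← mul_pow κ₁ (Real.sqrt H) 2]
    have := hκ1le (P j)
    gcongr
  have c2 : ∑ j, ‖b j * α j‖ ^ 2 ≤ κ₂ ^ 2 * H * ∑ j, ‖α j‖ ^ 2 := by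
    rw [Finset.mul_sum]
    refine Finset.sum_le_sum fun j _ => ?_
    rw [norm_mul, mul_pow, hb, ← hsq2, ← mul_pow κ₂ (Real.sqrt H) 2]
    have := hκ2le (P j)
    gcongr
  rw [abs_le] at g
  obtain ⟨g1, g2⟩ := g
  change A₁ * _ ≤ _ at r1
  change _ ≤ A₂ * _ at r2
  have hQ0 : 0 ≤ ∑ j, ‖b j * α j‖ ^ 2 := by positivity
  generalize (∑ k : Fin M, ‖∑ j, b j * α j * μ j ^ (k : ℕ)‖ ^ 2) = W at *
  generalize (∑ j, ‖b j * α j‖ ^ 2) = Q at *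
  generalize (∑ i, ‖∑ j, V i j * α j‖ ^ 2) = Y at *
  have hZ0 : 0 ≤ ∑ j, ‖α j‖ ^ 2 := by positivity
  generalize (∑ j, ‖α j‖ ^ 2) = Z at *
  clear_value A₁ A₂ κ₁ κ₂ ν H
  push_cast at g1 g2
  have hMν : (2 * (d : ℝ) - 1) * ν ≤ M * (ε / 2) := by
    rw [ge_iff_le, div_le_iff₀ hε] at hMbig
    linarith
  have hMH : M * H = 2 * d := by rw [hhnorm]; field_simp
  have hMQ := mul_le_mul_of_nonneg_right hMν hQ0
  have w1 : M * (1 - ε / 2) * Q ≤ W := by linarith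
  have w2 : W ≤ M * (1 + ε / 2) * Q := by linarith
  have hs1 : C * (1 - δ₀) = 2 * d * (κ₁ ^ 2 / A₂) := by
    rw [hCdef, hδ₀def]; field_simp; ring
  have hs2 : C * (1 + δ₀) = 2 * d * (κ₂ ^ 2 / A₁) := by
    rw [hCdef, hδ₀def]; field_simp; ring
  have ha : 0 < κ₁ ^ 2 / A₂ := by positivity
  have hb' : 0 < κ₂ ^ 2 / A₁ := by positivity
  have z1 : Y / A₂ ≤ Z := by rw [div_le_iff₀ hA2]; linarith
  have z2 : Z ≤ Y / A₁ := by rw [le_div_iff₀ hA1]; linarith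
  have hY0 : 0 ≤ Y := (mul_nonneg hA1.le hZ0).trans r1
  have hε2 : 0 ≤ 1 - ε / 2 := by
    have hCpos : 0 < C := by rw [hCdef]; positivity
    have h1 : C * ε < C * (1 - δ₀) := mul_lt_mul_of_pos_left hε' hCpos
    have h2 : C * (1 - δ₀) ≤ C * 2 := by
      rw [hs1, hCdef]
      nlinarith [mul_pos hd' hb']
    have := lt_of_mul_lt_mul_left (h1.trans_le h2) hCpos.le
    linarith
  constructor
  · have e : C * (1 - δ₀ - ε) = 2 * d * (κ₁ ^ 2 / A₂) * (1 - ε / 2) - d * (κ₂ ^ 2 / A₁) * ε := by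
      rw [show C * (1 - δ₀ - ε) = C * (1 - δ₀) - C * ε by ring, hs1, hCdef]; ring
    rw [e]
    calc _ ≤ 2 * d * (κ₁ ^ 2 / A₂) * (1 - ε / 2) * Y := by
          apply mul_le_mul_of_nonneg_right _ hY0
          have : 0 < d * (κ₂ ^ 2 / A₁) * ε := by positivity
          linarith
      _ = M * (1 - ε / 2) * (κ₁ ^ 2 * H * (Y / A₂)) := by rw [← hMH]; ring
      _ ≤ M * (1 - ε / 2) * (κ₁ ^ 2 * H * Z) := by gcongr
      _ ≤ M * (1 - ε / 2) * Q := by gcongr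
      _ ≤ W := w1
  · have e : C * (1 + δ₀ + ε) = 2 * d * (κ₂ ^ 2 / A₁) * (1 + ε / 2) + d * (κ₁ ^ 2 / A₂) * ε := by
      rw [show C * (1 + δ₀ + ε) = C * (1 + δ₀) + C * ε by ring, hs2, hCdef]; ring
    rw [e]
    calc W ≤ M * (1 + ε / 2) * Q := w2
      _ ≤ M * (1 + ε / 2) * (κ₂ ^ 2 * H * Z) := by gcongr
      _ ≤ M * (1 + ε / 2) * (κ₂ ^ 2 * H * (Y / A₁)) := by gcongr
      _ = 2 * d * (κ₂ ^ 2 / A₁) * (1 + ε / 2) * Y := by rw [← hMH]; ring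
      _ ≤ _ := by
          apply mul_le_mul_of_nonneg_right _ hY0
          have : 0 < d * (κ₁ ^ 2 / A₂) * ε := by positivity
          linarith
end

section
/- Suppose the A_Φ-eigenvalues e^{±iθ_iT_s} are pairwise distinct and each has nonzero imaginary part. Then for every row index j ∈ {1,…,2d}, the sum of the absolute values of the off-diagonal entries of G^H G in row j is at most (2d−1)·κ₂²·‖h‖₂²·ν. -/
open Complex Matrix Finset

lemma aux_geom_s8 (M : ℕ) (a : ℝ) (x : ℂ) (hx : x = Complex.exp (Complex.I * (a : ℂ)))
    (hne : x ≠ 1) : ‖∑ k : Fin M, x ^ (k : ℕ)‖ ≤ 1 / |Real.sin (a / 2)| := by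
  have h1 : ‖x - 1‖ = 2 * |Real.sin (a / 2)| := by
    rw [hx, Complex.norm_exp_I_mul_ofReal_sub_one]
    simp
  have hn : ‖x‖ = 1 := by
    rw [hx, mul_comm]; exact Complex.norm_exp_ofReal_mul_I a
  have hpos : 0 < ‖x - 1‖ := norm_pos_iff.mpr (sub_ne_zero.mpr hne)
  have hs : 0 < |Real.sin (a / 2)| := by linarith
  rw [Fin.sum_univ_eq_sum_range (fun k => x ^ k) M, le_div_iff₀ hs]
  have h2 : ‖∑ k ∈ Finset.range M, x ^ k‖ * ‖x - 1‖ ≤ 2 := by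
    rw [← norm_mul, geom_sum_mul]
    calc ‖x ^ M - 1‖ ≤ ‖x ^ M‖ + ‖(1 : ℂ)‖ := norm_sub_le _ _
      _ = 2 := by rw [norm_pow, hn]; norm_num
  rw [h1] at h2
  linarith

/-- Uniform bound on the Gershgorin radii: every off-diagonal absolute row sum
of `Gᴴ G` is at most `(2d−1)·κ₂²·‖h‖₂²·ν`. -/
theorem stmt8
    (N d M : ℕ) (hN : 0 < N) (hd : 0 < d) (hMpos : 0 < M) (hdN : 2 * d ≤ N)
    (θ : Fin d → ℝ) (hθpos : ∀ i, 0 < θ i) (hθinj : Function.Injective θ)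
    (Ts : ℝ) (hTs : 0 < Ts)
    (v : Fin d → Fin N → ℂ) (hvnorm : ∀ p, ∑ i, ‖v p i‖ ^ 2 = 1)
    (V : Matrix (Fin N) (Fin (2 * d)) ℂ)
    (hV : ∀ (i : Fin N) (j : Fin (2 * d)),
      V i j = if j.val % 2 = 0
        then v ⟨j.val / 2, by have := j.isLt; omega⟩ i
        else (starRingEnd ℂ) (v ⟨j.val / 2, by have := j.isLt; omega⟩ i))
    (hVrank : V.rank = 2 * d)
    (h : Fin N → ℝ) (hh : h ≠ 0)
    (μ : Fin (2 * d) → ℂ)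
    (hμ : ∀ j : Fin (2 * d),
      μ j = if j.val % 2 = 0
        then Complex.exp (-((θ ⟨j.val / 2, by have := j.isLt; omega⟩ * Ts : ℝ) : ℂ) * Complex.I)
        else Complex.exp (((θ ⟨j.val / 2, by have := j.isLt; omega⟩ * Ts : ℝ) : ℂ) * Complex.I))
    (G : Matrix (Fin M) (Fin (2 * d)) ℂ)
    (hG : ∀ (k : Fin M) (j : Fin (2 * d)), G k j = (∑ i, (h i : ℂ) * V i j) * μ j ^ (k : ℕ))
    (vh : Fin d → ℂ) (hvhdef : ∀ p, vh p = ∑ i, (starRingEnd ℂ) (v p i) * (h i : ℂ))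
    (hne : (Finset.univ : Finset (Fin d)).Nonempty)
    (κ₁ κ₂ : ℝ)
    (hκ₁def : κ₁ = Finset.univ.inf' hne fun p => ‖vh p‖ / Real.sqrt (∑ i, h i ^ 2))
    (hκ₂def : κ₂ = Finset.univ.sup' hne fun p => ‖vh p‖ / Real.sqrt (∑ i, h i ^ 2))
    (ν : ℝ)
    (hνdef : ν = sSup ({r : ℝ | ∃ p : Fin d, r = 1 / |Real.sin (θ p * Ts)|} ∪
      {r : ℝ | ∃ p q : Fin d, p ≠ q ∧
        (r = 1 / |Real.sin ((θ p - θ q) * Ts / 2)| ∨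
         r = 1 / |Real.sin ((θ p + θ q) * Ts / 2)|)}))
    (hμinj : Function.Injective μ) (hμim : ∀ j, (μ j).im ≠ 0) :
    ∀ j : Fin (2 * d),
      ∑ j' ∈ Finset.univ.erase j, ‖(Gᴴ * G) j j'‖
        ≤ (2 * (d : ℝ) - 1) * κ₂ ^ 2 * (∑ i, h i ^ 2) * ν := by
  intro j
  have hlt : ∀ j : Fin (2 * d), j.val / 2 < d := fun j => by have := j.isLt; omega
  obtain ⟨p, hp⟩ : ∃ p : Fin (2 * d) → Fin d, ∀ j, p j = ⟨j.val / 2, hlt j⟩ :=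
    ⟨_, fun _ => rfl⟩
  obtain ⟨φ, hφ⟩ : ∃ φ : Fin (2 * d) → ℝ, ∀ j, φ j =
      if j.val % 2 = 0 then -(θ (p j) * Ts) else θ (p j) * Ts := ⟨_, fun _ => rfl⟩
  have hμφ : ∀ j, μ j = Complex.exp ((φ j : ℂ) * Complex.I) := by
    intro j
    rw [hμ, hφ, hp]
    split_ifs <;> simp
  obtain ⟨c, hc⟩ : ∃ c : Fin (2 * d) → ℂ, ∀ j, c j = ∑ i, (h i : ℂ) * V i j :=
    ⟨_, fun _ => rfl⟩
  have hH : 0 < ∑ i, h i ^ 2 := by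
    obtain ⟨i, hi⟩ := Function.ne_iff.mp hh
    exact Finset.sum_pos' (fun i _ => sq_nonneg _) ⟨i, Finset.mem_univ _, by
      have : h i ≠ 0 := hi
      positivity⟩
  have hcn : ∀ j, ‖c j‖ = ‖vh (p j)‖ := by
    intro j
    rw [hc, hvhdef, hp]
    by_cases hj : j.val % 2 = 0
    · rw [← Complex.norm_conj, map_sum]
      congr 1
      refine Finset.sum_congr rfl fun i _ => ?_
      rw [hV, if_pos hj, map_mul, Complex.conj_ofReal, mul_comm]
    · congr 1
      refine Finset.sum_congr rfl fun i _ => ?_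
      rw [hV, if_neg hj, mul_comm]
  have hcb : ∀ j, ‖c j‖ ≤ κ₂ * Real.sqrt (∑ i, h i ^ 2) := by
    intro j
    rw [hcn, ← div_le_iff₀ (Real.sqrt_pos.mpr hH), hκ₂def]
    exact Finset.le_sup' (fun p => ‖vh p‖ / Real.sqrt (∑ i, h i ^ 2)) (Finset.mem_univ (p j))
  have hfin : ({r : ℝ | ∃ p : Fin d, r = 1 / |Real.sin (θ p * Ts)|} ∪
      {r : ℝ | ∃ p q : Fin d, p ≠ q ∧
        (r = 1 / |Real.sin ((θ p - θ q) * Ts / 2)| ∨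
         r = 1 / |Real.sin ((θ p + θ q) * Ts / 2)|)}).Finite := by
    refine Set.Finite.subset (Set.Finite.union
      (Set.finite_range fun p : Fin d => 1 / |Real.sin (θ p * Ts)|) (Set.Finite.union
      (Set.finite_range fun q : Fin d × Fin d => 1 / |Real.sin ((θ q.1 - θ q.2) * Ts / 2)|)
      (Set.finite_range fun q : Fin d × Fin d => 1 / |Real.sin ((θ q.1 + θ q.2) * Ts / 2)|))) ?_
    rintro r (⟨p, rfl⟩ | ⟨p, q, -, rfl | rfl⟩)
    · exact Or.inl ⟨p, rfl⟩
    · exact Or.inr (Or.inl ⟨(p, q), rfl⟩)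
    · exact Or.inr (Or.inr ⟨(p, q), rfl⟩)
  have hν1 : ∀ a : Fin d, 1 / |Real.sin (θ a * Ts)| ≤ ν := fun a => by
    rw [hνdef]; exact le_csSup hfin.bddAbove (Or.inl ⟨a, rfl⟩)
  have hν2 : ∀ a b : Fin d, a ≠ b → 1 / |Real.sin ((θ a - θ b) * Ts / 2)| ≤ ν := fun a b hab => by
    rw [hνdef]; exact le_csSup hfin.bddAbove (Or.inr ⟨a, b, hab, Or.inl rfl⟩)
  have hν3 : ∀ a b : Fin d, a ≠ b → 1 / |Real.sin ((θ a + θ b) * Ts / 2)| ≤ ν := fun a b hab => by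
    rw [hνdef]; exact le_csSup hfin.bddAbove (Or.inr ⟨a, b, hab, Or.inr rfl⟩)
  have hneg : ∀ x y : ℝ, x = -y → |Real.sin x| = |Real.sin y| := by
    rintro x y rfl; rw [Real.sin_neg, abs_neg]
  have hsin : ∀ j', j' ≠ j → 1 / |Real.sin ((φ j' - φ j) / 2)| ≤ ν := by
    intro j' hj'
    rw [hφ j', hφ j]
    by_cases hpq : p j' = p j
    · have hval : j'.val / 2 = j.val / 2 := by
        rw [hp, hp] at hpq; simpa using hpq
      have hvne : j'.val ≠ j.val := fun e => hj' (Fin.ext e)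
      rw [hpq]
      by_cases h1 : j'.val % 2 = 0
      · rw [if_pos h1, if_neg (by omega)]
        rw [hneg _ (θ (p j) * Ts) (by ring)]
        exact hν1 _
      · rw [if_neg h1, if_pos (by omega)]
        convert hν1 (p j) using 4
        ring
    · split_ifs
      · rw [hneg _ ((θ (p j') - θ (p j)) * Ts / 2) (by ring)]
        exact hν2 _ _ hpq
      · rw [hneg _ ((θ (p j') + θ (p j)) * Ts / 2) (by ring)]
        exact hν3 _ _ hpq
      · convert hν3 _ _ hpq using 4
        ring
      · convert hν2 _ _ hpq using 4
        ring
  have hν0 : 0 ≤ ν := le_trans (by positivity) (hν1 ⟨0, hd⟩)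
  have hentry : ∀ j' ∈ Finset.univ.erase j,
      ‖(Gᴴ * G) j j'‖ ≤ κ₂ ^ 2 * (∑ i, h i ^ 2) * ν := by
    intro j' hj'
    have hjne : j' ≠ j := Finset.ne_of_mem_erase hj'
    obtain ⟨x, hx⟩ : ∃ x : ℂ, x = (starRingEnd ℂ) (μ j) * μ j' := ⟨_, rfl⟩
    have hxe : x = Complex.exp (Complex.I * ((φ j' - φ j : ℝ) : ℂ)) := by
      rw [hx, hμφ, hμφ, ← Complex.exp_conj, ← Complex.exp_add]
      congr 1
      simp
      ring
    have hx1 : x ≠ 1 := by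
      intro e
      apply hjne
      apply hμinj
      rw [hxe] at e
      have : μ j' = Complex.exp (Complex.I * ((φ j' - φ j : ℝ) : ℂ)) * μ j := by
        rw [hμφ, hμφ, ← Complex.exp_add]
        congr 1
        push_cast
        ring
      rw [this, e, one_mul]
    have hsum : (Gᴴ * G) j j' = (starRingEnd ℂ) (c j) * c j' * ∑ k : Fin M, x ^ (k : ℕ) := by
      rw [Matrix.mul_apply, Finset.mul_sum]
      refine Finset.sum_congr rfl fun k _ => ?_
      rw [Matrix.conjTranspose_apply, hG, hG, ← hc, ← hc, hx, ← starRingEnd_apply, map_mul,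
        map_pow, mul_pow]
      ring
    have hb := (aux_geom_s8 M _ x hxe hx1).trans (hsin j' hjne)
    rw [hsum, norm_mul, norm_mul, Complex.norm_conj]
    have hK : κ₂ ^ 2 * (∑ i, h i ^ 2) =
        (κ₂ * Real.sqrt (∑ i, h i ^ 2)) * (κ₂ * Real.sqrt (∑ i, h i ^ 2)) := by
      rw [mul_mul_mul_comm, Real.mul_self_sqrt hH.le, sq]
    have hK0 := (norm_nonneg _).trans (hcb j)
    rw [hK]
    exact mul_le_mul (mul_le_mul (hcb j) (hcb j') (norm_nonneg _) hK0) hb (norm_nonneg _)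
      (mul_nonneg hK0 hK0)
  refine (Finset.sum_le_card_nsmul _ _ _ hentry).trans (le_of_eq ?_)
  rw [Finset.card_erase_of_mem (Finset.mem_univ _), Finset.card_univ, Fintype.card_fin,
    nsmul_eq_mul, Nat.cast_sub (by omega)]
  push_cast
  ring
end
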